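/- arXiv:2111.03191 — 5 statements merged into one kernel-verified Lean document; each statement's English description precedes it below -/
import Mathlib

section
/- For all real x, y, z ∈ [−1, 1], one has 0 ≤ (2 + x)(2 + y)(2 + z)(3 − x − y − z) ≤ (9/4)⁴; the maximum value (9/4)⁴ is attained at (x, y, z) = (1/4, 1/4, 1/4) and the minimum value 0 is attained at (x, y, z) = (1, 1, 1). -/
open Matrix Filter
open scoped Kronecker

/-- Mesh size `h = 1/(n+1)`. -/
noncomputable def meshH (n : ℕ) : ℝ := 1 / (n + 1)

/-- 1D finite-difference Laplacian: tridiagonal with diagonal `2/h²`,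
off-diagonals `-1/h²`. -/
noncomputable def lap (n : ℕ) : Matrix (Fin n) (Fin n) ℝ :=
  Matrix.of fun i j =>
    if (i : ℕ) = (j : ℕ) then 2 / meshH n ^ 2
    else if (i : ℕ) + 1 = (j : ℕ) ∨ (j : ℕ) + 1 = (i : ℕ) then -(1 / meshH n ^ 2)
    else 0

/-- 1D linear finite-element mass matrix: tridiagonal with diagonal `2h/3`,
off-diagonals `h/6`. -/
noncomputable def mass (n : ℕ) : Matrix (Fin n) (Fin n) ℝ :=
  Matrix.of fun i j =>
    if (i : ℕ) = (j : ℕ) then 2 * meshH n / 3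
    else if (i : ℕ) + 1 = (j : ℕ) ∨ (j : ℕ) + 1 = (i : ℕ) then meshH n / 6
    else 0

/-- The sine vector `v^{(k)}` with entries `sin (k π h i)`, `i = 1, …, n`. -/
noncomputable def sineVec (n k : ℕ) : Fin n → ℝ :=
  fun i => Real.sin (k * Real.pi * meshH n * ((i : ℕ) + 1))

/-- The inequality of arithmetic and geometric means for four real numbers. -/
theorem four_mul_le_avg_pow {a b c d : ℝ} (ha : 0 ≤ a) (hb : 0 ≤ b) (hc : 0 ≤ c) (hd : 0 ≤ d) :
    a * b * c * d ≤ ((a + b + c + d) / 4) ^ 4 := by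
  have two (u v : ℝ) : u * v ≤ ((u + v) / 2) ^ 2 := by nlinarith [sq_nonneg (u - v)]
  calc a * b * c * d = (a * b) * (c * d) := by ring
    _ ≤ ((a + b) / 2) ^ 2 * ((c + d) / 2) ^ 2 :=
      mul_le_mul (two a b) (two c d) (by positivity) (by positivity)
    _ = ((a + b) / 2 * ((c + d) / 2)) ^ 2 := by ring
    _ ≤ ((((a + b) / 2 + (c + d) / 2) / 2) ^ 2) ^ 2 :=
      pow_le_pow_left₀ (by positivity) (two _ _) 2
    _ = ((a + b + c + d) / 4) ^ 4 := by ring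

/-- extrema of `f₃(x,y,z) = (2+x)(2+y)(2+z)(3-x-y-z)` on `[-1,1]³`. -/
theorem stmt_12 :
    (∀ x y z : ℝ, x ∈ Set.Icc (-1 : ℝ) 1 → y ∈ Set.Icc (-1 : ℝ) 1 → z ∈ Set.Icc (-1 : ℝ) 1 →
      0 ≤ (2 + x) * (2 + y) * (2 + z) * (3 - x - y - z) ∧
        (2 + x) * (2 + y) * (2 + z) * (3 - x - y - z) ≤ (9 / 4 : ℝ) ^ 4) ∧
    (2 + (1 / 4 : ℝ)) * (2 + (1 / 4 : ℝ)) * (2 + (1 / 4 : ℝ)) * (3 - 1 / 4 - 1 / 4 - 1 / 4) =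
      (9 / 4 : ℝ) ^ 4 ∧
    (2 + (1 : ℝ)) * (2 + (1 : ℝ)) * (2 + (1 : ℝ)) * (3 - 1 - 1 - 1) = 0 := by
  refine ⟨fun x y z ⟨hx, hx'⟩ ⟨hy, hy'⟩ ⟨hz, hz'⟩ => ?_, by norm_num, by norm_num⟩
  have ha : 0 ≤ 2 + x := by linarith
  have hb : 0 ≤ 2 + y := by linarith
  have hc : 0 ≤ 2 + z := by linarith
  have hd : 0 ≤ 3 - x - y - z := by linarith
  refine ⟨by positivity, ?_⟩
  convert four_mul_le_avg_pow ha hb hc hd using 2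
  ring
end

section
/- For all integers n ≥ 1, with h = 1/(n+1), and all k₁, k₂ ∈ {1,…,n}, one has (2 + cos(πhk₁))(2 + cos(πhk₂))[(1 − cos(πhk₁)) + (1 − cos(πhk₂))] ≥ 2(2 + cos(πh))²(1 − cos(πh)); i.e., the smallest eigenvalue of T₂ is (4/9)(2 + cos(πh))²(1 − cos(πh)), attained at k₁ = k₂ = 1. -/
open Matrix Filter
open scoped Kronecker

/-- On the square `|x|, |y| ≤ c`, the product `(2 + x) (2 + y) (2 - x - y)` is smallest at the
corner `x = y = c`. -/
theorem two_add_mul_two_add_mul_ge {c x y : ℝ} (hx : |x| ≤ c) (hy : |y| ≤ c) :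
    2 * (2 + c) ^ 2 * (1 - c) ≤ (2 + x) * (2 + y) * ((1 - x) + (1 - y)) := by
  have hc : 0 ≤ c := (abs_nonneg x).trans hx
  have mul_le {a b p q : ℝ} (ha : |a| ≤ p) (hb : |b| ≤ q) (hp : 0 ≤ p) : |a * b| ≤ p * q := by
    rw [abs_mul]
    exact mul_le_mul ha hb (abs_nonneg b) hp
  have hxx := mul_le hx hx hc
  have hyy := mul_le hy hy hc
  have hxy := mul_le hx hy hc
  have hxxy := mul_le hxx hy (mul_nonneg hc hc)
  have hxyy := mul_le hxy hy (mul_nonneg hc hc)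
  linarith [le_of_abs_le hxx, le_of_abs_le hyy, le_of_abs_le hxy, le_of_abs_le hxxy,
    le_of_abs_le hxyy]

/-- The cosines at the interior nodes `k / (n + 1)` are bounded by the one at the first node. -/
theorem abs_cos_pi_mul_meshH_le {n k : ℕ} (hk : 1 ≤ k) (hk' : k ≤ n) :
    |Real.cos (Real.pi * meshH n * k)| ≤ Real.cos (Real.pi * meshH n) := by
  have hh : 0 < meshH n := by unfold meshH; positivity
  have hn : meshH n * (n + 1) = 1 := by unfold meshH; field_simp
  have ht : 0 < Real.pi * meshH n := mul_pos Real.pi_pos hh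
  have hπ : Real.pi * meshH n * (n + 1) = Real.pi := by rw [mul_assoc, hn, mul_one]
  have h1 : (1 : ℝ) ≤ k := by exact_mod_cast hk
  have h2 : (k : ℝ) ≤ n := by exact_mod_cast hk'
  have hlow : Real.pi * meshH n ≤ Real.pi * meshH n * k := le_mul_of_one_le_right ht.le h1
  have hupp : Real.pi * meshH n * k ≤ Real.pi - Real.pi * meshH n := by
    have := mul_le_mul_of_nonneg_left h2 ht.le
    linarith
  rw [abs_le, ← Real.cos_pi_sub]
  constructor
  · exact Real.cos_le_cos_of_nonneg_of_le_pi (by linarith) (by linarith) hupp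
  · exact Real.cos_le_cos_of_nonneg_of_le_pi ht.le (by linarith) hlow

/-- the smallest eigenvalue of `T₂` is attained at `k₁ = k₂ = 1`. -/
theorem stmt_13 (n : ℕ) (hn : 1 ≤ n) (k₁ k₂ : ℕ) (hk₁ : 1 ≤ k₁) (hk₁' : k₁ ≤ n)
    (hk₂ : 1 ≤ k₂) (hk₂' : k₂ ≤ n) :
    (2 + Real.cos (Real.pi * meshH n * k₁)) * (2 + Real.cos (Real.pi * meshH n * k₂)) *
        ((1 - Real.cos (Real.pi * meshH n * k₁)) + (1 - Real.cos (Real.pi * meshH n * k₂))) ≥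
      2 * (2 + Real.cos (Real.pi * meshH n)) ^ 2 * (1 - Real.cos (Real.pi * meshH n)) := by
  exact two_add_mul_two_add_mul_ge (abs_cos_pi_mul_meshH_le hk₁ hk₁')
    (abs_cos_pi_mul_meshH_le hk₂ hk₂')
end

section
/- The sequence r₁(n) = [(1 − cos(πn/(n+1)))·(2 + cos(π/(n+1)))] / [(2 + cos(π⌊2(n+1)/3⌋/(n+1)))·(1 − cos(π⌊2(n+1)/3⌋/(n+1)))] converges to 8/3 as n → ∞. -/
open Matrix Filter
open scoped Kronecker

/-- `⌊a m / b⌋ / m` tends to `a / b`, for natural numbers `a`, `b`. -/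
theorem tendsto_nat_mul_div_div_atTop (a b : ℕ) :
    Tendsto (fun m : ℕ => ((a * m / b : ℕ) : ℝ) / m) atTop (nhds ((a : ℝ) / b)) := by
  have h := (tendsto_nat_floor_mul_div_atTop (R := ℝ) (a := (a : ℝ) / b) (by positivity)).comp
    tendsto_natCast_atTop_atTop
  refine h.congr fun m => ?_
  have e : (a : ℝ) / b * m = ((a * m : ℕ) : ℝ) / b := by push_cast; ring
  simp only [Function.comp_apply, e, Nat.floor_div_eq_div]

/-- the 1D condition-number ratio `r₁(n) = κ/κₚ` tends to `8/3`. -/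
theorem stmt_17 :
    Filter.Tendsto (fun n : ℕ =>
      ((1 - Real.cos (Real.pi * n / (n + 1))) * (2 + Real.cos (Real.pi / (n + 1)))) /
        ((2 + Real.cos (Real.pi * ((2 * (n + 1) / 3 : ℕ) : ℝ) / (n + 1))) *
          (1 - Real.cos (Real.pi * ((2 * (n + 1) / 3 : ℕ) : ℝ) / (n + 1)))))
      Filter.atTop (nhds (8 / 3)) := by
  have h₁ : Tendsto (fun n : ℕ => Real.cos (Real.pi * n / (n + 1))) atTop (nhds (-1)) := by
    have h := (tendsto_natCast_div_add_atTop (1 : ℝ)).const_mul Real.pi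
    rw [mul_one] at h
    simpa [Function.comp_def, mul_div_assoc] using (Real.continuous_cos.tendsto _).comp h
  have h₂ : Tendsto (fun n : ℕ => Real.cos (Real.pi / (n + 1))) atTop (nhds 1) := by
    have h := (tendsto_one_div_add_atTop_nhds_zero_nat (𝕜 := ℝ)).const_mul Real.pi
    rw [mul_zero] at h
    simpa [Function.comp_def, div_eq_mul_inv] using (Real.continuous_cos.tendsto _).comp h
  have h₃ : Tendsto (fun n : ℕ =>
      Real.cos (Real.pi * ((2 * (n + 1) / 3 : ℕ) : ℝ) / (n + 1))) atTop (nhds (-(1 / 2))) := by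
    have h := ((tendsto_nat_mul_div_div_atTop 2 3).comp (tendsto_add_atTop_nat 1)).const_mul
      Real.pi
    have e : Real.cos (Real.pi * (((2 : ℕ) : ℝ) / ((3 : ℕ) : ℝ))) = -(1 / 2) := by
      rw [← Real.cos_pi_div_three, ← Real.cos_pi_sub]
      congr 1
      push_cast
      ring
    rw [← e]
    refine ((Real.continuous_cos.tendsto _).comp h).congr fun n => ?_
    simp only [Function.comp_apply, Nat.cast_add, Nat.cast_one, mul_div_assoc]
  have h := ((h₁.const_sub 1).mul (h₂.const_add 2)).div ((h₃.const_add 2).mul (h₃.const_sub 1))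
    (by norm_num)
  have e : (8 / 3 : ℝ) = (1 - -1) * (2 + 1) / ((2 + -(1 / 2)) * (1 - -(1 / 2))) := by norm_num
  rw [e]
  exact h
end

section
/- The sequence r₂(n) = [(1 − cos(πn/(n+1)))·(2 + cos(π/(n+1)))²] / [(2 + cos(π⌊(n+1)/2⌋/(n+1)))²·(1 − cos(π⌊(n+1)/2⌋/(n+1)))] converges to 9/2 as n → ∞. -/
open Matrix Filter
open scoped Kronecker

theorem tendsto_natCast_succ_half_div_succ :
    Tendsto (fun n : ℕ => (((n + 1) / 2 : ℕ) : ℝ) / (n + 1)) atTop (nhds (1 / 2)) := by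
  have h := (tendsto_nat_floor_mul_div_atTop (R := ℝ) (a := 1 / 2) (by norm_num)).comp
    (tendsto_natCast_atTop_atTop.comp (tendsto_add_atTop_nat 1))
  refine h.congr fun n => ?_
  have hfloor : ⌊(1 / 2 : ℝ) * ((n + 1 : ℕ) : ℝ)⌋₊ = (n + 1) / 2 := by
    rw [one_div_mul_eq_div]
    exact Nat.floor_div_eq_div (K := ℝ) (n + 1) 2
  rw [Function.comp_apply, Function.comp_apply, hfloor, Nat.cast_add_one]

/-- the 2D condition-number ratio `r₂(n) = κ/κₚ` tends to `9/2`. -/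
theorem stmt_18 :
    Filter.Tendsto (fun n : ℕ =>
      ((1 - Real.cos (Real.pi * n / (n + 1))) * (2 + Real.cos (Real.pi / (n + 1))) ^ 2) /
        ((2 + Real.cos (Real.pi * (((n + 1) / 2 : ℕ) : ℝ) / (n + 1))) ^ 2 *
          (1 - Real.cos (Real.pi * (((n + 1) / 2 : ℕ) : ℝ) / (n + 1)))))
      Filter.atTop (nhds (9 / 2)) := by
  have half : Tendsto (fun n : ℕ => (((n + 1) / 2 : ℕ) : ℝ) / (n + 1)) atTop (nhds (1 / 2)) :=
    tendsto_natCast_succ_half_div_succ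
  have succ : Tendsto (fun n : ℕ => (n : ℝ) / (n + 1)) atTop (nhds 1) :=
    tendsto_natCast_div_add_atTop 1
  have inv : Tendsto (fun n : ℕ => (1 : ℝ) / (n + 1)) atTop (nhds 0) :=
    tendsto_one_div_add_atTop_nhds_zero_nat
  have cos_pi_mul {u : ℕ → ℝ} {a : ℝ} (hu : Tendsto u atTop (nhds a)) :
      Tendsto (fun n => Real.cos (Real.pi * u n)) atTop (nhds (Real.cos (Real.pi * a))) :=
    (Real.continuous_cos.tendsto _).comp (hu.const_mul Real.pi)
  have cos_half : Real.cos (Real.pi * (1 / 2)) = 0 := by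
    rw [mul_one_div, Real.cos_pi_div_two]
  have hnum := ((cos_pi_mul succ).const_sub 1).mul (((cos_pi_mul inv).const_add 2).pow 2)
  have hden := (((cos_pi_mul half).const_add 2).pow 2).mul ((cos_pi_mul half).const_sub 1)
  have hlim := hnum.div hden (by rw [cos_half]; norm_num)
  rw [cos_half, mul_one, mul_zero, Real.cos_pi, Real.cos_zero] at hlim
  convert hlim using 2
  · simp only [Pi.div_apply, mul_div_assoc, mul_one_div]
  · norm_num
end

section
/- The sequence r₃(n) = [(1 − cos(πn/(n+1)))·(2 + cos(π/(n+1)))³] / [(2 + cos(πβ/(n+1)))³·(1 − cos(πβ/(n+1)))], where β = ⌊arccos(1/4)·(n+1)/π⌋, converges to 2⁹/3⁴ = 512/81 as n → ∞. -/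
open Matrix Filter
open scoped Kronecker

open Topology in
/-- Rounding `b * (n + 1) / a` down changes `b` only by a vanishing amount after rescaling. -/
theorem tendsto_mul_natFloor_div_succ {a b : ℝ} (ha : 0 < a) (hb : 0 ≤ b) :
    Tendsto (fun n : ℕ => a * (⌊b * (n + 1) / a⌋₊ : ℝ) / (n + 1)) atTop (𝓝 b) := by
  have hsucc : Tendsto (fun n : ℕ => (n : ℝ) + 1) atTop atTop :=
    tendsto_atTop_add_const_right _ _ tendsto_natCast_atTop_atTop
  have h := ((tendsto_nat_floor_mul_div_atTop (div_nonneg hb ha.le)).comp hsucc).const_mul a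
  rw [mul_div_cancel₀ _ ha.ne'] at h
  refine h.congr fun n => ?_
  simp only [Function.comp_apply, div_mul_eq_mul_div, mul_div_assoc]

/-- the 3D condition-number ratio `r₃(n) = κ/κₚ` tends to `2⁹/3⁴ = 512/81`. -/
theorem stmt_19 :
    Filter.Tendsto (fun n : ℕ =>
      ((1 - Real.cos (Real.pi * n / (n + 1))) * (2 + Real.cos (Real.pi / (n + 1))) ^ 3) /
        ((2 + Real.cos (Real.pi * ((⌊Real.arccos (1 / 4) * (n + 1) / Real.pi⌋₊ : ℕ) : ℝ) /
              (n + 1))) ^ 3 *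
          (1 - Real.cos (Real.pi * ((⌊Real.arccos (1 / 4) * (n + 1) / Real.pi⌋₊ : ℕ) : ℝ) /
              (n + 1)))))
      Filter.atTop (nhds (512 / 81)) := by
  have hcos_max : Tendsto (fun n : ℕ => Real.cos (Real.pi * n / (n + 1))) atTop (nhds (-1)) := by
    have h := (tendsto_natCast_div_add_atTop (1 : ℝ)).const_mul Real.pi
    rw [mul_one] at h
    simpa only [Function.comp_def, Real.cos_pi, mul_div_assoc] using
      (Real.continuous_cos.tendsto Real.pi).comp h
  have hcos_min : Tendsto (fun n : ℕ => Real.cos (Real.pi / (n + 1))) atTop (nhds 1) := by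
    have h := (tendsto_one_div_add_atTop_nhds_zero_nat (𝕜 := ℝ)).const_mul Real.pi
    rw [mul_zero] at h
    simpa only [Function.comp_def, Real.cos_zero, mul_one_div] using
      (Real.continuous_cos.tendsto 0).comp h
  have hcos_crit : Tendsto (fun n : ℕ => Real.cos (Real.pi *
      ((⌊Real.arccos (1 / 4) * (n + 1) / Real.pi⌋₊ : ℕ) : ℝ) / (n + 1))) atTop
      (nhds (1 / 4)) := by
    have h := (Real.continuous_cos.tendsto _).comp
      (tendsto_mul_natFloor_div_succ Real.pi_pos (Real.arccos_nonneg (1 / 4)))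
    rwa [Real.cos_arccos (by norm_num) (by norm_num)] at h
  have h := ((hcos_max.const_sub 1).mul ((hcos_min.const_add 2).pow 3)).div
    (((hcos_crit.const_add 2).pow 3).mul (hcos_crit.const_sub 1)) (by norm_num)
  have hval : (1 - (-1 : ℝ)) * (2 + 1) ^ 3 / ((2 + 1 / 4) ^ 3 * (1 - 1 / 4)) = 512 / 81 := by
    norm_num
  rwa [hval] at h
end
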